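/- Let A be an alphabet with 1 ∈ A and δ_A > 1/2, and write A_max = max A. Let M be a real number with M ≥ 2⁹·A_max³·(log M)³, let p ≥ 1 be an integer such that the continuant c_p of the sequence of p ones satisfies √(log M) ≤ c_p ≤ 2·√(log M), and let S₂ be the set of finite sequences D of even length k ≥ 2p over A whose first p and last p entries equal 1 and with M/(64·A_max²) ≤ ⟨D⟩ ≤ M. Then there exists a real number L with M/(64·A_max²) ≤ L ≤ M such that the set S₃(L) = {D ∈ S₂ : max(M/(64·A_max²), L·(1 − 1/log L)) ≤ ⟨D⟩ ≤ L} satisfies #S₃(L) ≥ L^{2δ_A}/(2¹⁶·A_max⁵·(log L)³). -/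

import Mathlib

/-- Continuant `⟨d₁,…,d_k⟩`. -/
def cont : List ℕ → ℕ
  | [] => 1
  | [d] => d
  | d :: e :: D => d * cont (e :: D) + cont D

/-- The Gauss map `y ↦ {1/y}`. -/
noncomputable def gaussMap (y : ℝ) : ℝ := Int.fract (1 / y)

/-- The set `E_A`. -/
def cfSet (A : Finset ℕ) : Set ℝ :=
  {x | x ∈ Set.Ioo (0:ℝ) 1 ∧ Irrational x ∧
    ∀ n : ℕ, ∃ a ∈ A, (a : ℤ) = ⌊1 / (gaussMap^[n] x)⌋}

/-- `δ_A`, the Hausdorff dimension of `E_A`. -/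
noncomputable def cfDim (A : Finset ℕ) : ℝ := (dimH (cfSet A)).toReal

/-- The set `S₂`: sequences over `A` of even length `k ≥ 2p` whose first `p` and last `p`
entries equal `1`, with continuant in `[M/(64 A_max²), M]`. -/
def S2set (A : Finset ℕ) (Am M : ℝ) (p : ℕ) : Set (List ℕ) :=
  {L | Even L.length ∧ 2 * p ≤ L.length ∧ (∀ d ∈ L, d ∈ A) ∧
    L.take p = List.replicate p 1 ∧ L.drop (L.length - p) = List.replicate p 1 ∧
    M / (64 * Am ^ 2) ≤ (cont L : ℝ) ∧ (cont L : ℝ) ≤ M}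


/-- The set `S₃(L)`: elements of `S₂` with continuant in
`[max(M/(64 A_max²), L(1 − 1/log L)), L]`. -/
def S3set (A : Finset ℕ) (Am M : ℝ) (p : ℕ) (L : ℝ) : Set (List ℕ) :=
  {D ∈ S2set A Am M p |
    max (M / (64 * Am ^ 2)) (L * (1 - 1 / Real.log L)) ≤ (cont D : ℝ) ∧ (cont D : ℝ) ≤ L}

open MeasureTheory Set Filter Topology

section Continuant

lemma cont_pos {D : List ℕ} (h : ∀ d ∈ D, 0 < d) : 0 < cont D := by
  induction D using cont.induct with
  | case1 => simp [cont]
  | case2 d => simpa [cont] using h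
  | case3 d e D _ ih =>
    rw [cont]
    have := ih fun x hx => h x (by simp [hx])
    omega

lemma cont_le_cons {d : ℕ} {D : List ℕ} (hd : 0 < d) : cont D ≤ cont (d :: D) := by
  cases D with
  | nil => simp [cont]; omega
  | cons e D =>
    rw [cont]
    nlinarith [Nat.zero_le (cont D), Nat.zero_le (cont (e :: D))]

lemma length_le_cont {D : List ℕ} (h : ∀ d ∈ D, 0 < d) : D.length ≤ cont D := by
  induction D using cont.induct with
  | case1 => simp
  | case2 d => simpa [cont, Nat.one_le_iff_ne_zero, Nat.pos_iff_ne_zero] using h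
  | case3 d e D ih _ =>
    rw [cont, List.length_cons]
    have h1 := ih fun x hx => h x (by simp_all)
    have h2 : 0 < cont D := cont_pos fun x hx => h x (by simp [hx])
    have h3 : 0 < d := h d (by simp)
    nlinarith

lemma cont_mul_cont_le (u v : List ℕ) : cont u * cont v ≤ cont (u ++ v) := by
  induction u using cont.induct with
  | case1 => simp [cont]
  | case2 d => cases v <;> simp [cont]
  | case3 d e D ih1 ih2 =>
    simp only [List.cons_append, cont] at ih1 ih2 ⊢
    nlinarith

lemma cont_append_le (u : List ℕ) {v : List ℕ} (hu : ∀ d ∈ u, 0 < d) (hv : ∀ d ∈ v, 0 < d) :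
    cont (u ++ v) ≤ 2 * cont u * cont v := by
  induction u using cont.induct with
  | case1 => simp [cont]; omega
  | case2 d =>
    have hd : 0 < d := hu d (by simp)
    cases v with
    | nil => simp [cont]; omega
    | cons e D =>
      simp only [List.cons_append, List.nil_append, cont]
      have := cont_le_cons (D := D) (hv e (by simp))
      nlinarith
  | case3 d e D ih1 ih2 =>
    have h1 := ih1 fun x hx => hu x (by simp_all)
    have h2 := ih2 fun x hx => hu x (by simp [hx])
    simp only [List.cons_append, cont] at h1 h2 ⊢
    nlinarith

lemma cont_append_singleton_le {u : List ℕ} (hu : ∀ d ∈ u, 0 < d) (a : ℕ) :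
    cont (u ++ [a]) ≤ (a + 1) * cont u := by
  induction u using cont.induct with
  | case1 => simp [cont]
  | case2 d =>
    have hd : 0 < d := hu d (by simp)
    simp only [List.cons_append, List.nil_append, cont]
    nlinarith
  | case3 d e D ih1 ih2 =>
    have h1 := ih1 fun x hx => hu x (by simp_all)
    have h2 := ih2 fun x hx => hu x (by simp [hx])
    simp only [List.cons_append, cont] at h1 h2 ⊢
    nlinarith

lemma finite_setOf_cont_le {A : Finset ℕ} (hpos : ∀ a ∈ A, 0 < a) (N : ℝ) :
    {D : List ℕ | (∀ d ∈ D, d ∈ A) ∧ (cont D : ℝ) ≤ N}.Finite := by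
  refine ((List.finite_length_le A ⌊N⌋₊).image (List.map Subtype.val)).subset ?_
  rintro D ⟨hD, hN⟩
  refine ⟨D.attach.map fun d => ⟨d.1, hD d.1 d.2⟩, ?_, by simp⟩
  simp only [mem_ofPred_eq, List.length_map, List.length_attach]
  exact (length_le_cont fun d hd => hpos d (hD d hd)).trans (Nat.le_floor hN)

end Continuant

section InverseBranch

/-- The continued fraction `[0; d₁, …, d_k + x]`, as a function of `x`. -/
noncomputable def cfBranch : List ℕ → ℝ → ℝ
  | [], x => x
  | d :: D, x => 1 / (d + cfBranch D x)

/-- The denominator of the Möbius map `cfBranch D` at `x`. -/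
noncomputable def cfDen : List ℕ → ℝ → ℝ
  | [], _ => 1
  | d :: D, x => (d + cfBranch D x) * cfDen D x

lemma cfBranch_append (u v : List ℕ) (x : ℝ) :
    cfBranch (u ++ v) x = cfBranch u (cfBranch v x) := by
  induction u with
  | nil => rfl
  | cons d u ih => simp [cfBranch, ih]

lemma cfBranch_nonneg (D : List ℕ) {x : ℝ} (hx : 0 ≤ x) : 0 ≤ cfBranch D x := by
  induction D with
  | nil => exact hx
  | cons d D ih => rw [cfBranch]; positivity

lemma cont_le_cfDen {D : List ℕ} (h : ∀ d ∈ D, 0 < d) {x : ℝ} (hx : 0 ≤ x) :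
    (cont D : ℝ) ≤ cfDen D x := by
  induction D using cont.induct with
  | case1 => simp [cont, cfDen]
  | case2 d => simpa [cont, cfDen, cfBranch] using hx
  | case3 d e D ih1 ih2 =>
    have h1 := ih1 fun y hy => h y (by simp_all)
    have h2 := ih2 fun y hy => h y (by simp [hy])
    have hD := cfBranch_nonneg D hx
    have he : (0 : ℝ) < e := by exact_mod_cast h e (by simp)
    have key : cfDen (d :: e :: D) x = d * cfDen (e :: D) x + cfDen D x := by
      simp only [cfDen, cfBranch]
      field_simp
    rw [key, cont]
    push_cast
    gcongr

lemma abs_cfBranch_sub_mul {D : List ℕ} (h : ∀ d ∈ D, 0 < d) {x y : ℝ} (hx : 0 ≤ x)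
    (hy : 0 ≤ y) :
    |cfBranch D x - cfBranch D y| * (cfDen D x * cfDen D y) = |x - y| := by
  induction D with
  | nil => simp [cfBranch, cfDen]
  | cons d D ih =>
    have hd : (0 : ℝ) < d := by exact_mod_cast h d (by simp)
    rw [← ih fun z hz => h z (by simp [hz])]
    have h1 := cfBranch_nonneg D hx
    have h2 := cfBranch_nonneg D hy
    have key : cfBranch (d :: D) x - cfBranch (d :: D) y =
        (cfBranch D y - cfBranch D x) / ((d + cfBranch D x) * (d + cfBranch D y)) := by
      simp only [cfBranch]
      field_simp
      ring
    have hp : 0 < (d + cfBranch D x) * (d + cfBranch D y) := by positivity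
    rw [key, abs_div, abs_of_pos hp, abs_sub_comm]
    simp only [cfDen]
    field_simp

lemma abs_cfBranch_sub_le {D : List ℕ} (h : ∀ d ∈ D, 0 < d) {x y : ℝ} (hx : 0 ≤ x)
    (hy : 0 ≤ y) :
    |cfBranch D x - cfBranch D y| ≤ |x - y| / (cont D : ℝ) ^ 2 := by
  have hc : (0 : ℝ) < cont D := by exact_mod_cast cont_pos h
  rw [le_div_iff₀ (by positivity), ← abs_cfBranch_sub_mul h hx hy, sq]
  have h1 := cont_le_cfDen h hx
  have h2 := cont_le_cfDen h hy
  gcongr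
  exact hc.le.trans h1

lemma exists_cfBranch_singleton {A : Finset ℕ} {x : ℝ} (hx : x ∈ cfSet A) :
    ∃ a ∈ A, ∃ y ∈ cfSet A, x = cfBranch [a] y := by
  obtain ⟨⟨hx0, hx1⟩, hirr, hdig⟩ := hx
  obtain ⟨a, ha, hax⟩ := hdig 0
  have hinv : Irrational (1 / x) := by simpa using hirr.inv
  have hy : Irrational (gaussMap x) := by
    rw [gaussMap, Int.fract]
    exact hinv.sub_intCast _
  refine ⟨a, ha, gaussMap x, ⟨⟨?_, Int.fract_lt_one _⟩, hy, fun n => ?_⟩, ?_⟩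
  · exact lt_of_le_of_ne (Int.fract_nonneg _) hy.ne_zero.symm
  · simpa only [Function.iterate_succ_apply] using hdig (n + 1)
  · have hax' : (a : ℝ) = (⌊1 / x⌋ : ℝ) := by exact_mod_cast hax
    simp only [cfBranch, gaussMap, hax', Int.floor_add_fract, one_div_one_div]

end InverseBranch

section Stopping

/-- Words over `A` whose continuant exceeds `N` for the first time at their last letter. -/
def stoppingWords (A : Finset ℕ) (N : ℝ) : Set (List ℕ) :=
  {w | (∀ d ∈ w, d ∈ A) ∧ N < cont w ∧ ∃ u a, w = u ++ [a] ∧ (cont u : ℝ) ≤ N}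

variable {A : Finset ℕ} {N : ℝ}

lemma cont_le_of_mem_stoppingWords (hA : A.Nonempty) (hpos : ∀ a ∈ A, 0 < a) {w : List ℕ}
    (hw : w ∈ stoppingWords A N) : (cont w : ℝ) ≤ ((A.max' hA : ℝ) + 1) * N := by
  obtain ⟨hwA, -, u, a, rfl, hu⟩ := hw
  have ha : (a : ℝ) ≤ A.max' hA := by exact_mod_cast A.le_max' a (hwA a (by simp))
  have h := cont_append_singleton_le (fun d hd => hpos d (hwA d (by simp [hd]))) (u := u) a
  calc (cont (u ++ [a]) : ℝ) ≤ (a + 1) * cont u := by exact_mod_cast h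
    _ ≤ _ := by gcongr

lemma finite_stoppingWords (hA : A.Nonempty) (hpos : ∀ a ∈ A, 0 < a) :
    (stoppingWords A N).Finite :=
  (finite_setOf_cont_le hpos _).subset fun _ hw =>
    ⟨hw.1, cont_le_of_mem_stoppingWords hA hpos hw⟩

lemma append_singleton_notMem_stoppingWords {w : List ℕ} (hw : w ∈ stoppingWords A N) (a : ℕ) :
    w ++ [a] ∉ stoppingWords A N := by
  rintro ⟨-, -, u, b, hub, hu⟩
  obtain ⟨rfl, -⟩ := List.append_inj' hub rfl
  exact hu.not_gt hw.2.1

lemma exists_stoppingWord_cfBranch (hpos : ∀ a ∈ A, 0 < a) (hN : 1 ≤ N) {x : ℝ}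
    (hx : x ∈ cfSet A) : ∃ w ∈ stoppingWords A N, ∃ y ∈ cfSet A, x = cfBranch w y := by
  by_contra! hcon
  have key : ∀ n : ℕ, ∃ w : List ℕ, w.length = n ∧ (∀ d ∈ w, d ∈ A) ∧ (cont w : ℝ) ≤ N ∧
      ∃ y ∈ cfSet A, x = cfBranch w y := by
    intro n
    induction n with
    | zero => exact ⟨[], rfl, by simp, by simpa [cont] using hN, x, hx, rfl⟩
    | succ n ih =>
      obtain ⟨w, hlen, hwA, hwN, y, hy, hxy⟩ := ih
      obtain ⟨a, ha, z, hz, hyz⟩ := exists_cfBranch_singleton hy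
      have hxz : x = cfBranch (w ++ [a]) z := by rw [cfBranch_append, ← hyz, hxy]
      have hA' : ∀ d ∈ w ++ [a], d ∈ A := by
        intro d hd
        rcases List.mem_append.1 hd with h | h
        · exact hwA d h
        · rwa [List.mem_singleton.1 h]
      refine ⟨w ++ [a], by simp [hlen], hA', ?_, z, hz, hxz⟩
      by_contra! hlt
      exact hcon _ ⟨hA', hlt, w, a, rfl, hwN⟩ z hz hxz
  obtain ⟨w, hlen, hwA, hwN, -⟩ := key (⌊N⌋₊ + 1)
  have h1 : w.length ≤ ⌊N⌋₊ :=
    (length_le_cont fun d hd => hpos d (hwA d hd)).trans (Nat.le_floor hwN)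
  omega

/-- Iterating a stopping-time cover gives covers by exponentially small pieces. -/
lemma exists_iterated_cover (hA : A.Nonempty) (hpos : ∀ a ∈ A, 0 < a) (hN : 1 ≤ N) (k : ℕ) :
    ∃ T : Finset (List ℕ), T.card ≤ (stoppingWords A N).ncard ^ k ∧
      (∀ w ∈ T, (∀ d ∈ w, 0 < d) ∧ N ^ k ≤ cont w) ∧
      ∀ x ∈ cfSet A, ∃ w ∈ T, ∃ y ∈ cfSet A, x = cfBranch w y := by
  classical
  have hfin : (stoppingWords A N).Finite := finite_stoppingWords hA hpos
  induction k with
  | zero => exact ⟨{[]}, by simp, by simp [cont], fun x hx => ⟨[], by simp, x, hx, rfl⟩⟩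
  | succ k ih =>
    obtain ⟨T, hcard, hT, hcov⟩ := ih
    refine ⟨Finset.image₂ (· ++ ·) T hfin.toFinset, ?_, ?_, ?_⟩
    · refine (Finset.card_image₂_le _ _ _).trans ?_
      rw [pow_succ, ← Set.ncard_eq_toFinset_card _ hfin]
      gcongr
    · intro w hw
      obtain ⟨u, hu, v, hv, rfl⟩ := Finset.mem_image₂.1 hw
      rw [Set.Finite.mem_toFinset] at hv
      refine ⟨fun d hd => ?_, ?_⟩
      · rcases List.mem_append.1 hd with h | h
        · exact (hT u hu).1 d h
        · exact hpos d (hv.1 d h)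
      · calc N ^ (k + 1) = N ^ k * N := pow_succ _ _
          _ ≤ cont u * cont v := by
            gcongr
            · exact (hT u hu).2
            · exact hv.2.1.le
          _ ≤ cont (u ++ v) := by exact_mod_cast cont_mul_cont_le u v
    · intro x hx
      obtain ⟨u, hu, y, hy, rfl⟩ := hcov x hx
      obtain ⟨v, hv, z, hz, rfl⟩ := exists_stoppingWord_cfBranch hpos hN hy
      exact ⟨u ++ v, Finset.mem_image₂.2 ⟨u, hu, v, hfin.mem_toFinset.2 hv, rfl⟩, z, hz,
        (cfBranch_append u v z).symm⟩

lemma ediam_cfBranch_image_le {D : List ℕ} (h : ∀ d ∈ D, 0 < d) {c : ℝ} (hc : 0 < c)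
    (hcD : c ≤ cont D) :
    Metric.ediam (cfBranch D '' cfSet A) ≤ ENNReal.ofReal ((c ^ 2)⁻¹) := by
  refine Metric.ediam_le ?_
  rintro _ ⟨x, hx, rfl⟩ _ ⟨y, hy, rfl⟩
  rw [edist_dist, Real.dist_eq]
  refine ENNReal.ofReal_le_ofReal ((abs_cfBranch_sub_le h hx.1.1.le hy.1.1.le).trans ?_)
  rw [← one_div]
  have : |x - y| ≤ 1 := by
    rw [abs_le]
    constructor <;> linarith [hx.1.1, hx.1.2, hy.1.1, hy.1.2]
  gcongr

lemma dimH_cfSet_le (hA : A.Nonempty) (hpos : ∀ a ∈ A, 0 < a) (hN : 1 < N) {s : NNReal}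
    (hs : ((stoppingWords A N).ncard : ℝ) < N ^ (2 * (s : ℝ))) : dimH (cfSet A) ≤ s := by
  set K := (stoppingWords A N).ncard
  have hN0 : 0 < N := by linarith
  choose T hcard hT hcov using exists_iterated_cover hA hpos hN.le
  have hz : μH[(s : ℝ)] (cfSet A) ≤ 0 := by
    refine (Measure.hausdorffMeasure_le_liminf_sum (l := atTop) (ι := fun n => T n)
      (s : ℝ) (cfSet A) (fun n => ENNReal.ofReal (((N ^ n) ^ 2)⁻¹)) ?_
      (fun n w => cfBranch w.1 '' cfSet A) ?_ ?_).trans ?_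
    · rw [← ENNReal.ofReal_zero]
      refine ENNReal.tendsto_ofReal ?_
      refine tendsto_inv_atTop_zero.comp ?_
      exact (tendsto_pow_atTop two_ne_zero).comp (tendsto_pow_atTop_atTop_of_one_lt hN)
    · exact .of_forall fun n w =>
        ediam_cfBranch_image_le (hT n w.1 w.2).1 (by positivity) (hT n w.1 w.2).2
    · refine .of_forall fun n x hx => ?_
      obtain ⟨w, hw, y, hy, rfl⟩ := hcov n x hx
      exact mem_iUnion.2 ⟨⟨w, hw⟩, y, hy, rfl⟩
    · set ρ : ℝ := K / N ^ (2 * (s : ℝ))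
      have hρ0 : 0 ≤ ρ := by positivity
      have hρ1 : ρ < 1 := (div_lt_one (by positivity)).2 hs
      have hlim : Tendsto (fun n : ℕ => ENNReal.ofReal (ρ ^ n)) atTop (𝓝 0) := by
        rw [← ENNReal.ofReal_zero]
        exact ENNReal.tendsto_ofReal (tendsto_pow_atTop_nhds_zero_of_lt_one hρ0 hρ1)
      rw [← hlim.liminf_eq]
      refine liminf_le_liminf (.of_forall fun n => ?_)
      calc ∑ w : T n, Metric.ediam (cfBranch w.1 '' cfSet A) ^ (s : ℝ)
          ≤ ∑ w : T n, ENNReal.ofReal (((N ^ n) ^ 2)⁻¹) ^ (s : ℝ) := by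
            gcongr with w
            exact ediam_cfBranch_image_le (hT n w.1 w.2).1 (by positivity) (hT n w.1 w.2).2
        _ = ENNReal.ofReal ((T n).card * (((N ^ n) ^ 2)⁻¹) ^ (s : ℝ)) := by
            rw [ENNReal.ofReal_rpow_of_nonneg (by positivity) s.coe_nonneg,
              ENNReal.ofReal_mul (by positivity)]
            simp
        _ ≤ ENNReal.ofReal (ρ ^ n) := by
            refine ENNReal.ofReal_le_ofReal ?_
            have hpow : (((N ^ n) ^ 2)⁻¹) ^ (s : ℝ) = ((N ^ (2 * (s : ℝ))) ^ n)⁻¹ := by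
              rw [Real.inv_rpow (by positivity), ← pow_mul, ← Real.rpow_natCast N,
                ← Real.rpow_mul hN0.le, ← Real.rpow_mul_natCast hN0.le]
              push_cast
              ring_nf
            rw [hpow, div_pow, div_eq_mul_inv]
            gcongr
            exact_mod_cast hcard n
  exact dimH_le_of_hausdorffMeasure_ne_top (by simp [le_zero_iff.1 hz])

lemma rpow_cfDim_le_ncard_stoppingWords (hA : A.Nonempty) (hpos : ∀ a ∈ A, 0 < a) (hN : 1 < N)
    (hδ : 0 < cfDim A) : N ^ (2 * cfDim A) ≤ (stoppingWords A N).ncard := by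
  by_contra! hlt
  set K := (stoppingWords A N).ncard
  have hlogN : 0 < Real.log N := Real.log_pos hN
  have hN0 : 0 < N := by linarith
  have hs0 : max (Real.log K / (2 * Real.log N)) 0 < cfDim A := by
    refine max_lt ?_ hδ
    rcases Nat.eq_zero_or_pos K with h | h
    · simpa [h] using hδ
    · have h' : (0 : ℝ) < K := by exact_mod_cast h
      have := Real.log_lt_log h' hlt
      rw [Real.log_rpow hN0] at this
      rw [div_lt_iff₀ (by positivity)]
      linarith
  obtain ⟨s, hs1, hs2⟩ := exists_between hs0
  obtain ⟨hs3, hs4⟩ := max_lt_iff.1 hs1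
  have hKs : (K : ℝ) < N ^ (2 * s) := by
    rcases Nat.eq_zero_or_pos K with h | h
    · rw [h]; simp; positivity
    · have h' : (0 : ℝ) < K := by exact_mod_cast h
      rw [← Real.log_lt_log_iff h' (by positivity), Real.log_rpow hN0]
      rw [div_lt_iff₀ (by positivity)] at hs3
      linarith
  lift s to NNReal using hs4.le
  have : cfDim A ≤ s := by
    simpa [cfDim] using
      ENNReal.toReal_mono ENNReal.coe_ne_top (dimH_cfSet_le hA hpos hN hKs)
  linarith

end Stopping

lemma cfDim_le_one (A : Finset ℕ) : cfDim A ≤ 1 := by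
  have h : dimH (cfSet A) ≤ 1 :=
    (dimH_mono (subset_univ _)).trans_eq Real.dimH_univ
  simpa [cfDim] using ENNReal.toReal_mono ENNReal.one_ne_top h

section Padding

/-- Pad a word to even length by a final `1` if necessary, then put `p` ones on either side. -/
def padWord (p : ℕ) (w : List ℕ) : List ℕ :=
  List.replicate p 1 ++ (if Even w.length then w else w ++ [1]) ++ List.replicate p 1

variable {A : Finset ℕ} {N : ℝ} {p : ℕ}

lemma even_length_padWord (w : List ℕ) : Even (padWord p w).length := by
  unfold padWord
  split_ifs with h <;> simp [parity_simps, h]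

lemma mem_of_mem_padWord (h1 : 1 ∈ A) {w : List ℕ} (hw : ∀ d ∈ w, d ∈ A) :
    ∀ d ∈ padWord p w, d ∈ A := by
  intro d hd
  unfold padWord at hd
  split_ifs at hd <;> simp only [List.mem_append, List.mem_replicate, List.mem_singleton] at hd <;>
    grind

lemma padWord_injOn : InjOn (padWord p) (stoppingWords A N) := by
  intro u hu v hv huv
  simp only [padWord, List.append_left_inj, List.append_right_inj] at huv
  split_ifs at huv with h1 h2 h2
  · exact huv
  · exact absurd (huv ▸ hu) (append_singleton_notMem_stoppingWords hv 1)
  · exact absurd (huv ▸ hv) (append_singleton_notMem_stoppingWords hu 1)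
  · simpa using huv

lemma cont_padWord_bounds {w : List ℕ} (hw : ∀ d ∈ w, 0 < d) :
    cont (List.replicate p 1) ^ 2 * cont w ≤ cont (padWord p w) ∧
      cont (padWord p w) ≤ 8 * cont (List.replicate p 1) ^ 2 * cont w := by
  have hr : ∀ d ∈ List.replicate p 1, 0 < d := fun d hd => by
    simp [List.eq_of_mem_replicate hd]
  have hm : ∃ v : List ℕ, (if Even w.length then w else w ++ [1]) = v ∧ (∀ d ∈ v, 0 < d) ∧
      cont w ≤ cont v ∧ cont v ≤ 2 * cont w := by
    split_ifs
    · exact ⟨w, rfl, hw, le_rfl, by omega⟩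
    · refine ⟨w ++ [1], rfl, fun d hd => ?_, ?_, cont_append_singleton_le hw 1⟩
      · rcases List.mem_append.1 hd with h | h
        · exact hw d h
        · simp [List.mem_singleton.1 h]
      · simpa [cont] using cont_mul_cont_le w [1]
  obtain ⟨v, hv, hvpos, hwv, hvw⟩ := hm
  rw [padWord, hv]
  have hrv : ∀ d ∈ List.replicate p 1 ++ v, 0 < d := fun d hd =>
    (List.mem_append.1 hd).elim (hr d) (hvpos d)
  set c := cont (List.replicate p 1)
  have l1 := cont_mul_cont_le (List.replicate p 1) v
  have l2 := cont_mul_cont_le (List.replicate p 1 ++ v) (List.replicate p 1)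
  have u1 := cont_append_le (List.replicate p 1) hr hvpos
  have u2 := cont_append_le (List.replicate p 1 ++ v) hrv hr
  constructor
  · calc c ^ 2 * cont w = c * cont w * c := by ring
      _ ≤ c * cont v * c := by gcongr
      _ ≤ cont (List.replicate p 1 ++ v) * c := by gcongr
      _ ≤ _ := l2
  · calc _ ≤ 2 * cont (List.replicate p 1 ++ v) * c := u2
      _ ≤ 2 * (2 * c * cont v) * c := by gcongr
      _ ≤ 2 * (2 * c * (2 * cont w)) * c := by gcongr
      _ = _ := by ring

lemma padWord_mem_S2set (h1 : 1 ∈ A) {w : List ℕ} (hw : ∀ d ∈ w, d ∈ A) {B M : ℝ}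
    (hlow : M / (64 * B ^ 2) ≤ cont (padWord p w)) (hup : (cont (padWord p w) : ℝ) ≤ M) :
    padWord p w ∈ S2set A B M p := by
  refine ⟨even_length_padWord w, ?_, mem_of_mem_padWord h1 hw, ?_, ?_, hlow, hup⟩
  · simp only [padWord, List.length_append, List.length_replicate]
    omega
  · rw [padWord, List.append_assoc, List.take_left' (by simp)]
  · rw [padWord]
    exact List.drop_left' (by simp [add_comm])

end Padding

lemma finite_S3set {A : Finset ℕ} (hpos : ∀ a ∈ A, 0 < a) (B M : ℝ) (p : ℕ) (L : ℝ) :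
    (S3set A B M p L).Finite :=
  (finite_setOf_cont_le hpos L).subset fun _ hD => ⟨hD.1.2.2.1, hD.2.2⟩

section Numerics

variable {B M : ℝ}

lemma twelve_le_log (hB : 2 ≤ B) (hM : 2 ^ 9 * B ^ 3 * Real.log M ^ 3 ≤ M)
    (hM0 : 1 / 4 ≤ Real.log M) : 12 ≤ Real.log M := by
  have hB3 : 2 ^ 3 ≤ B ^ 3 := by gcongr
  have hlog2 := Real.log_two_gt_d9
  have step : ∀ t : ℝ, 0 ≤ t → t ≤ Real.log M → 2 ^ 12 * t ^ 3 ≤ M := fun t ht htM => by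
    calc 2 ^ 12 * t ^ 3 = 2 ^ 9 * 2 ^ 3 * t ^ 3 := by ring
      _ ≤ 2 ^ 9 * B ^ 3 * Real.log M ^ 3 := by gcongr
      _ ≤ M := hM
  have h4 : 4 ≤ Real.log M := by
    have h : (2 : ℝ) ^ 6 ≤ M := by linarith [step (1 / 4) (by norm_num) hM0]
    have := Real.log_le_log (by positivity) h
    rw [Real.log_pow] at this
    push_cast at this
    linarith
  have h : (2 : ℝ) ^ 18 ≤ M := by linarith [step 4 (by norm_num) h4]
  have := Real.log_le_log (by positivity) h
  rw [Real.log_pow] at this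
  push_cast at this
  linarith

lemma log_le_three_mul_log (hB : 2 ≤ B) (hM : 2 ^ 9 * B ^ 3 * Real.log M ^ 3 ≤ M)
    (hℓ : 12 ≤ Real.log M) (hM0 : 0 < M) {L : ℝ} (hL : M / (64 * B ^ 2) ≤ L) :
    Real.log M ≤ 3 * Real.log L := by
  have hMB : 2 ^ 9 * B ^ 3 ≤ M := by
    refine le_trans (le_mul_of_one_le_right (by positivity) ?_) hM
    exact one_le_pow₀ (by linarith)
  have hL0 : 0 < L := lt_of_lt_of_le (by positivity) hL
  have key : M ≤ L ^ 3 := by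
    calc M = M ^ 3 / M ^ 2 := by field_simp
      _ ≤ M ^ 3 / (2 ^ 9 * B ^ 3) ^ 2 := by gcongr
      _ = (M / (64 * B ^ 2)) ^ 3 := by field_simp; norm_num
      _ ≤ L ^ 3 := by gcongr
  have := Real.log_le_log hM0 key
  rw [Real.log_pow] at this
  exact_mod_cast this

lemma window_count_bound (hB : 2 ≤ B) {ℓ : ℝ} (hℓ : 12 ≤ ℓ) :
    27 * (B + 1) ^ 2 * (Real.log (64 * B ^ 2) * ℓ + 1) ≤ 64 * B ^ 5 * ℓ := by
  have hlog : Real.log (64 * B ^ 2) ≤ 3.546 + B := by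
    have h1 : 64 * B ^ 2 = 2 ^ 8 * (B / 2) ^ 2 := by ring
    have h2 := Real.log_le_sub_one_of_pos (show 0 < B / 2 by positivity)
    rw [h1, Real.log_mul (by positivity) (by positivity), Real.log_pow, Real.log_pow]
    push_cast
    linarith [Real.log_two_lt_d9]
  have h1 : Real.log (64 * B ^ 2) * ℓ + 1 ≤ (3.63 + B) * ℓ := by nlinarith
  have h2 : (B + 1) ^ 2 ≤ 9 / 4 * B ^ 2 := by nlinarith
  have h3 : 27 * (9 / 4 * (3.63 + B)) ≤ 64 * B ^ 3 := by nlinarith [sq_nonneg (B - 2)]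
  calc 27 * (B + 1) ^ 2 * (Real.log (64 * B ^ 2) * ℓ + 1)
      ≤ 27 * (B + 1) ^ 2 * ((3.63 + B) * ℓ) := by gcongr
    _ ≤ 27 * (9 / 4 * B ^ 2) * ((3.63 + B) * ℓ) := by gcongr
    _ = 27 * (9 / 4 * (3.63 + B)) * (B ^ 2 * ℓ) := by ring
    _ ≤ 64 * B ^ 3 * (B ^ 2 * ℓ) := by gcongr
    _ = _ := by ring

lemma rpow_div_le_of_window_count (hB : 2 ≤ B) {δ N L J K : ℝ} (hδ0 : 0 < δ) (hδ1 : δ ≤ 1)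
    (hN : 0 < N) (hMN : M = 32 * (B + 1) * Real.log M * N) (hℓ : 12 ≤ Real.log M)
    (hL0 : 0 < L) (hLM : L ≤ M) (hlogL : Real.log M ≤ 3 * Real.log L) (hJ : 0 < J)
    (hJ' : J ≤ Real.log (64 * B ^ 2) * Real.log M + 1) (hK : N ^ (2 * δ) ≤ K) :
    L ^ (2 * δ) / (2 ^ 16 * B ^ 5 * Real.log L ^ 3) ≤ K / J := by
  set ℓ := Real.log M
  have hℓL : 0 < Real.log L := by linarith
  have hc : 1 ≤ 32 * (B + 1) * ℓ := by nlinarith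
  have h1 : L ^ (2 * δ) ≤ (32 * (B + 1) * ℓ) ^ 2 * K := by
    calc L ^ (2 * δ) ≤ M ^ (2 * δ) := by gcongr
      _ = (32 * (B + 1) * ℓ) ^ (2 * δ) * N ^ (2 * δ) := by
        rw [hMN, Real.mul_rpow (by positivity) hN.le]
      _ ≤ (32 * (B + 1) * ℓ) ^ (2 : ℝ) * K := by
        gcongr
        · linarith
      _ = _ := by rw [Real.rpow_two]
  have hK0 : 0 < K := lt_of_lt_of_le (by positivity) hK
  have h2 : 27 * (B + 1) ^ 2 * J ≤ 64 * B ^ 5 * ℓ :=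
    le_trans (by gcongr) (window_count_bound hB hℓ)
  have h3 : ℓ ^ 3 ≤ 27 * Real.log L ^ 3 := by
    calc ℓ ^ 3 ≤ (3 * Real.log L) ^ 3 := by gcongr
      _ = _ := by ring
  rw [div_le_div_iff₀ (by positivity) hJ]
  have h4 : 27 * ((32 * (B + 1) * ℓ) ^ 2 * J) ≤ 27 * (2 ^ 16 * B ^ 5 * Real.log L ^ 3) := by
    calc 27 * ((32 * (B + 1) * ℓ) ^ 2 * J) = 2 ^ 10 * ℓ ^ 2 * (27 * (B + 1) ^ 2 * J) := by ring
      _ ≤ 2 ^ 10 * ℓ ^ 2 * (64 * B ^ 5 * ℓ) := by gcongr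
      _ = 2 ^ 16 * B ^ 5 * ℓ ^ 3 := by ring
      _ ≤ 2 ^ 16 * B ^ 5 * (27 * Real.log L ^ 3) := by gcongr
      _ = _ := by ring
  calc L ^ (2 * δ) * J ≤ (32 * (B + 1) * ℓ) ^ 2 * K * J := by gcongr
    _ = K * ((32 * (B + 1) * ℓ) ^ 2 * J) := by ring
    _ ≤ _ := mul_le_mul_of_nonneg_left (by linarith) hK0.le

/-- With `j = ⌊log (M / x) · log M⌋`, the point `x` lies in `[L (1 - 1 / log L), L]` for
`L = M exp (-j / log M)`. -/
lemma mem_log_window {x : ℝ} (hx1 : 1 < x) (hxM : x ≤ M)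
    {L : ℝ} (hL : L = M * Real.exp (-(⌊Real.log (M / x) * Real.log M⌋₊ / Real.log M))) :
    L * (1 - 1 / Real.log L) ≤ x ∧ x ≤ L ∧ L ≤ M := by
  have hx : 0 < x := by linarith
  have hM : 0 < M := by linarith
  have hℓ : 0 < Real.log M := Real.log_pos (by linarith)
  set ℓ := Real.log M
  set t := Real.log (M / x)
  have ht : 0 ≤ t := Real.log_nonneg ((one_le_div hx).2 hxM)
  have hxt : x = M * Real.exp (-t) := by
    rw [Real.exp_neg, Real.exp_log (by positivity)]
    field_simp
  have hL0 : 0 < L := by rw [hL]; positivity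
  have hLM : L ≤ M := by
    rw [hL]
    refine mul_le_of_le_one_right hM.le (Real.exp_le_one_iff.2 ?_)
    rw [neg_nonpos]
    positivity
  have hj1 : (⌊t * ℓ⌋₊ : ℝ) / ℓ ≤ t := (div_le_iff₀ hℓ).2 (Nat.floor_le (by positivity))
  have hj2 : t ≤ ⌊t * ℓ⌋₊ / ℓ + 1 / ℓ := by
    rw [← add_div, le_div_iff₀ hℓ]
    exact (Nat.lt_floor_add_one _).le
  have hxL : x ≤ L := by
    rw [hL, hxt]
    gcongr
  refine ⟨?_, hxL, hLM⟩
  have h1 : 1 - 1 / Real.log L ≤ Real.exp (-(1 / ℓ)) := by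
    have h2 : 1 / ℓ ≤ 1 / Real.log L :=
      one_div_le_one_div_of_le (Real.log_pos (by linarith)) (Real.log_le_log hL0 hLM)
    linarith [Real.add_one_le_exp (-(1 / ℓ))]
  calc L * (1 - 1 / Real.log L) ≤ L * Real.exp (-(1 / ℓ)) := by gcongr
    _ = M * Real.exp (-(⌊t * ℓ⌋₊ / ℓ + 1 / ℓ)) := by
      rw [hL, mul_assoc, ← Real.exp_add]
      ring_nf
    _ ≤ M * Real.exp (-t) := by gcongr
    _ = x := hxt.symm

end Numerics

/-- there is `L ∈ [M/(64 A_max²), M]` with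
`#S₃(L) ≥ L^{2δ_A}/(2¹⁶ A_max⁵ (log L)³)`. -/
theorem S3_lower_bound (A : Finset ℕ) (hcard : 2 ≤ A.card) (hpos : ∀ a ∈ A, 0 < a)
    (hA : A.Nonempty) (h1 : 1 ∈ A) (hδ : 1 / 2 < cfDim A)
    (M : ℝ) (hM : 2 ^ 9 * (A.max' hA : ℝ) ^ 3 * (Real.log M) ^ 3 ≤ M)
    (p : ℕ) (hp : 1 ≤ p)
    (hcp1 : Real.sqrt (Real.log M) ≤ (cont (List.replicate p 1) : ℝ))
    (hcp2 : (cont (List.replicate p 1) : ℝ) ≤ 2 * Real.sqrt (Real.log M)) :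
    ∃ L : ℝ, M / (64 * (A.max' hA : ℝ) ^ 2) ≤ L ∧ L ≤ M ∧
      L ^ (2 * cfDim A) / (2 ^ 16 * (A.max' hA : ℝ) ^ 5 * (Real.log L) ^ 3) ≤
        ((S3set A (A.max' hA : ℝ) M p L).ncard : ℝ) := by
  classical
  set B : ℝ := (A.max' hA : ℝ) with hBdef
  have hB : 2 ≤ B := by
    obtain ⟨a, ha, ha1⟩ := Finset.exists_mem_ne (by omega : 1 < A.card) 1
    have h2 : 2 ≤ a := by have := hpos a ha; omega
    rw [hBdef]
    exact_mod_cast h2.trans (A.le_max' a ha)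
  set c := cont (List.replicate p 1)
  have hr : ∀ d ∈ List.replicate p 1, 0 < d := fun d hd => by
    simp [List.eq_of_mem_replicate hd]
  have hc1 : (1 : ℝ) ≤ c := by exact_mod_cast cont_pos hr
  have hlog4 : 1 / 4 ≤ Real.log M := by
    by_contra! h
    have : Real.sqrt (Real.log M) < 1 / 2 := by
      rw [Real.sqrt_lt' (by norm_num)]
      linarith
    linarith
  have hℓ := twelve_le_log hB hM hlog4
  set ℓ := Real.log M
  have hM0 : 0 < M := lt_of_lt_of_le (by positivity) hM
  have hcl : ℓ ≤ (c : ℝ) ^ 2 := by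
    rw [← Real.sqrt_le_left (by positivity)]
    exact hcp1
  have hcu : (c : ℝ) ^ 2 ≤ 4 * ℓ := by
    calc (c : ℝ) ^ 2 ≤ (2 * Real.sqrt ℓ) ^ 2 := by gcongr
      _ = 4 * ℓ := by rw [mul_pow, Real.sq_sqrt (by linarith)]; ring
  set N := M / (32 * (B + 1) * ℓ) with hNdef
  have hMN : M = 32 * (B + 1) * ℓ * N := by rw [hNdef]; field_simp
  have hN1 : 1 < N := by
    rw [hNdef, one_lt_div (by positivity)]
    refine lt_of_lt_of_le ?_ hM
    have h1 : B + 1 ≤ B ^ 3 := by nlinarith [sq_nonneg (B - 1)]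
    have h2 : ℓ ≤ ℓ ^ 3 := le_self_pow₀ (by linarith) (by norm_num)
    calc 32 * (B + 1) * ℓ < 2 ^ 9 * (B + 1) * ℓ := by gcongr; norm_num
      _ ≤ 2 ^ 9 * B ^ 3 * ℓ ^ 3 := by gcongr
  have hfin : (stoppingWords A N).Finite := finite_stoppingWords hA hpos
  have hK := rpow_cfDim_le_ncard_stoppingWords hA hpos hN1 (by linarith)
  have hS2 : ∀ w ∈ stoppingWords A N, padWord p w ∈ S2set A B M p := by
    intro w hw
    obtain ⟨hl, hu⟩ := cont_padWord_bounds (p := p) fun d hd => hpos d (hw.1 d hd)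
    have hl' : (c : ℝ) ^ 2 * cont w ≤ cont (padWord p w) := by exact_mod_cast hl
    have hu' : (cont (padWord p w) : ℝ) ≤ 8 * (c : ℝ) ^ 2 * cont w := by exact_mod_cast hu
    refine padWord_mem_S2set h1 hw.1 ?_ ?_
    · calc M / (64 * B ^ 2) ≤ M / (32 * (B + 1)) := by gcongr 1; nlinarith
        _ = ℓ * N := by rw [hNdef]; field_simp
        _ ≤ (c : ℝ) ^ 2 * cont w := by
          gcongr
          exact hw.2.1.le
        _ ≤ _ := hl'
    · calc (cont (padWord p w) : ℝ) ≤ 8 * (c : ℝ) ^ 2 * cont w := hu'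
        _ ≤ 8 * (4 * ℓ) * ((B + 1) * N) := by
          gcongr
          exact cont_le_of_mem_stoppingWords hA hpos hw
        _ = M := by rw [hNdef]; field_simp; ring
  set S := hfin.toFinset.image (padWord p) with hSdef
  have hScard : S.card = (stoppingWords A N).ncard := by
    rw [hSdef, Finset.card_image_of_injOn (by simpa using padWord_injOn),
      ← Set.ncard_eq_toFinset_card _ hfin]
  have hSS2 : ∀ D ∈ S, D ∈ S2set A B M p := by
    intro D hD
    obtain ⟨w, hw, rfl⟩ := Finset.mem_image.1 hD
    exact hS2 w (hfin.mem_toFinset.1 hw)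
  let f : List ℕ → ℕ := fun D => ⌊Real.log (M / cont D) * ℓ⌋₊
  set t := Real.log (64 * B ^ 2) * ℓ
  have ht : 0 ≤ t := mul_nonneg (Real.log_nonneg (by nlinarith)) (by linarith)
  have hf : ∀ D ∈ S, f D ∈ Finset.range (⌊t⌋₊ + 1) := by
    intro D hD
    have hlow := (hSS2 D hD).2.2.2.2.2.1
    have hD0 : (0 : ℝ) < cont D := lt_of_lt_of_le (by positivity) hlow
    rw [Finset.mem_range, Nat.lt_succ_iff]
    refine Nat.floor_le_floor ?_
    have : M / cont D ≤ 64 * B ^ 2 := by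
      rwa [div_le_comm₀ hD0 (by positivity)]
    exact mul_le_mul_of_nonneg_right (Real.log_le_log (by positivity) this) (by linarith)
  set J : ℝ := ((⌊t⌋₊ + 1 : ℕ) : ℝ)
  have hJ : 0 < J := by positivity
  have hJt : J ≤ t + 1 := by
    simp only [J, Nat.cast_add, Nat.cast_one]
    gcongr
    exact Nat.floor_le ht
  have hK0 : (0 : ℝ) < (stoppingWords A N).ncard := lt_of_lt_of_le (by positivity) hK
  obtain ⟨j, -, hj⟩ := Finset.exists_le_card_fiber_of_nsmul_le_card_of_maps_to
    (b := ((stoppingWords A N).ncard : ℝ) / J) hf (by simp) (by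
      rw [hScard, Finset.card_range, nsmul_eq_mul]
      exact (mul_div_cancel₀ _ hJ.ne').le)
  set L := M * Real.exp (-(j / ℓ)) with hLdef
  have hne : (S.filter fun D => f D = j).Nonempty := by
    rw [← Finset.card_pos]
    exact_mod_cast lt_of_lt_of_le (div_pos hK0 hJ) hj
  have hone : 1 < M / (64 * B ^ 2) := by
    have := log_le_three_mul_log hB hM hℓ hM0 le_rfl
    exact (Real.log_pos_iff (by positivity)).1 (by linarith)
  have hwin : ∀ D ∈ S.filter fun D => f D = j,
      L * (1 - 1 / Real.log L) ≤ cont D ∧ (cont D : ℝ) ≤ L ∧ L ≤ M := by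
    intro D hD
    obtain ⟨hDS, hDj⟩ := Finset.mem_filter.1 hD
    obtain ⟨-, -, -, -, -, hlow, hup⟩ := hSS2 D hDS
    exact mem_log_window (hone.trans_le hlow) hup (by rw [hLdef, ← hDj])
  obtain ⟨D₀, hD₀⟩ := hne
  obtain ⟨-, hD₀L, hLM⟩ := hwin D₀ hD₀
  have hlowL : M / (64 * B ^ 2) ≤ L :=
    (hSS2 D₀ (Finset.mem_filter.1 hD₀).1).2.2.2.2.2.1.trans hD₀L
  refine ⟨L, hlowL, hLM, ?_⟩
  have hlogL := log_le_three_mul_log hB hM hℓ hM0 hlowL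
  refine (rpow_div_le_of_window_count hB (by linarith) (cfDim_le_one A) (by linarith) hMN hℓ
    (by linarith) hLM hlogL hJ hJt hK).trans (hj.trans ?_)
  rw [← Set.ncard_coe_finset]
  have hsub : ((S.filter fun D => f D = j : Finset (List ℕ)) : Set (List ℕ)) ⊆
      S3set A B M p L := by
    intro D hD
    obtain ⟨hw1, hw2, -⟩ := hwin D hD
    have hDS := hSS2 D (Finset.mem_filter.1 hD).1
    exact ⟨hDS, max_le hDS.2.2.2.2.2.1 hw1, hw2⟩
  exact_mod_cast Set.ncard_le_ncard hsub (finite_S3set hpos B M p L)
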